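/- Let A and B be real Banach spaces with closed unit balls B_A and B_B, let Â ⊆ B_A and B̂ ⊆ B_B be dense subsets, and let ε > 0. Then the following are equivalent: (1) there exist ε' ∈ (0, ε), a correspondence R between Â and B̂, a real Banach space C, and linear isometric embeddings ι_A : A → C and ι_B : B → C with ‖ι_A(a) − ι_B(b)‖ ≤ ε' for all (a,b) ∈ R; (2) there exist ε' ∈ (0, ε) and a correspondence R between Â and B̂ such that for every n, all (a_0,b_0), …, (a_{n−1},b_{n−1}) ∈ R and all real coefficients λ_0, …, λ_{n−1} with ∑_{i<n}|λ_i| = 1, we have |‖∑_{i<n} λ_i a_i‖ − ‖∑_{i<n} λ_i b_i‖| ≤ ε'. -/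

import Mathlib

open scoped BigOperators

/-- A vector that is norm-minimal in its coset modulo `N` keeps its norm in the quotient by the
closure of `N`. -/
theorem norm_mk_topologicalClosure_eq {X : Type*} [NormedAddCommGroup X] [NormedSpace ℝ X]
    (N : Submodule ℝ X) (x : X) (h : ∀ m ∈ N, ‖x‖ ≤ ‖x + m‖) :
    ‖(Submodule.Quotient.mk x : X ⧸ N.topologicalClosure)‖ = ‖x‖ := by
  have hcl : ∀ m ∈ N.topologicalClosure, ‖x‖ ≤ ‖x + m‖ := by
    intro m hm
    have hclosed : IsClosed {m : X | ‖x‖ ≤ ‖x + m‖} :=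
      isClosed_le continuous_const (by fun_prop)
    exact closure_minimal (fun m hm => h m hm) hclosed hm
  refine le_antisymm (Submodule.Quotient.norm_mk_le _ x) (le_of_forall_pos_lt_add ?_)
  intro δ hδ
  obtain ⟨y, hy, hlt⟩ := Submodule.Quotient.norm_mk_lt
    (Submodule.Quotient.mk x : X ⧸ N.topologicalClosure) hδ
  have hmem : y - x ∈ N.topologicalClosure := (Submodule.Quotient.eq _).1 hy
  have := hcl _ hmem
  rw [add_sub_cancel] at this
  exact this.trans_lt hlt

theorem Finset.sum_equivFin_symm {ι M : Type*} [AddCommMonoid M] (s : Finset ι) (f : ι → M) :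
    ∑ j, f (s.equivFin.symm j) = ∑ i ∈ s, f i := by
  rw [← Finset.sum_coe_sort s f]
  exact s.equivFin.symm.sum_comp fun i : s => f i

/-- A norm comparison on absolutely convex combinations extends by homogeneity to all linear
combinations over a finite set. -/
theorem abs_norm_sub_norm_le_of_absConvex {A B : Type*}
    [NormedAddCommGroup A] [NormedSpace ℝ A] [NormedAddCommGroup B] [NormedSpace ℝ B]
    {R : Set (A × B)} {r : ℝ}
    (h : ∀ (n : ℕ) (p : Fin n → A × B), (∀ i, p i ∈ R) →
      ∀ lam : Fin n → ℝ, ∑ i, |lam i| = 1 →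
        |‖∑ i, lam i • (p i).1‖ - ‖∑ i, lam i • (p i).2‖| ≤ r)
    (s : Finset R) (c : R → ℝ) :
    |‖∑ i ∈ s, c i • i.1.1‖ - ‖∑ i ∈ s, c i • i.1.2‖| ≤ r * ∑ i ∈ s, |c i| := by
  set t := ∑ i ∈ s, |c i| with ht
  have ht0 : 0 ≤ t := Finset.sum_nonneg fun i _ => abs_nonneg _
  rcases ht0.eq_or_lt with h0 | hpos
  · have hc : ∀ i ∈ s, c i = 0 := fun i hi => abs_eq_zero.1 <|
      (Finset.sum_eq_zero_iff_of_nonneg fun i _ => abs_nonneg _).1 h0.symm i hi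
    rw [Finset.sum_eq_zero fun i hi => by rw [hc i hi, zero_smul],
      Finset.sum_eq_zero fun i hi => by rw [hc i hi, zero_smul], ← h0]
    simp
  · have key := h s.card (fun j => (s.equivFin.symm j).1.1) (fun j => (s.equivFin.symm j).1.2)
      (fun j => t⁻¹ * c (s.equivFin.symm j)) (by
        rw [s.sum_equivFin_symm fun i => |t⁻¹ * c i|]
        simp_rw [abs_mul, ← Finset.mul_sum, abs_of_pos (inv_pos.2 hpos)]
        exact inv_mul_cancel₀ hpos.ne')
    rw [s.sum_equivFin_symm fun i => (t⁻¹ * c i) • i.1.1, s.sum_equivFin_symm fun i => (t⁻¹ * c i) • i.1.2] at key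
    simp_rw [mul_smul, ← Finset.smul_sum, norm_smul, ← mul_sub, abs_mul, norm_inv,
      Real.norm_of_nonneg ht0, abs_of_pos (inv_pos.2 hpos)] at key
    rwa [inv_mul_le_iff₀ hpos, mul_comm] at key

/-- If the norms of linear combinations of `R`-related points differ by at most `r` times the
`ℓ¹`-norm of the coefficients, then both spaces embed isometrically into a common Banach space
where related points are at distance at most `r`. The space is a quotient of
`A ⊕₁ B ⊕₁ ℓ¹(R)`. -/
theorem exists_common_isometric_extension {A B : Type}
    [NormedAddCommGroup A] [NormedSpace ℝ A] [CompleteSpace A]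
    [NormedAddCommGroup B] [NormedSpace ℝ B] [CompleteSpace B]
    {R : Set (A × B)} {r : ℝ} (hr : 0 ≤ r)
    (h : ∀ (s : Finset R) (c : R → ℝ),
      |‖∑ i ∈ s, c i • i.1.1‖ - ‖∑ i ∈ s, c i • i.1.2‖| ≤ r * ∑ i ∈ s, |c i|) :
    ∃ (C : Type) (_ : NormedAddCommGroup C) (_ : NormedSpace ℝ C)
      (_ : CompleteSpace C) (ιA : A →ₗᵢ[ℝ] C) (ιB : B →ₗᵢ[ℝ] C),
      ∀ p ∈ R, ‖ιA p.1 - ιB p.2‖ ≤ r := by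
  classical
  let E := lp (fun _ : R => ℝ) 1
  let X := WithLp 1 (WithLp 1 (A × B) × E)
  let e : R → E := fun i => lp.single 1 i r
  let mkX : A → B → E → X := fun a b f => WithLp.toLp 1 (WithLp.toLp 1 (a, b), f)
  have norm_mkX : ∀ a b f, ‖mkX a b f‖ = ‖a‖ + ‖b‖ + ‖f‖ := by
    intro a b f
    exact (WithLp.prod_norm_eq_of_L1 _).trans
      (congrArg (· + ‖f‖) (WithLp.prod_norm_eq_of_L1 (WithLp.toLp 1 (a, b))))
  have mkX_add : ∀ a b f a' b' f',
      mkX a b f + mkX a' b' f' = mkX (a + a') (b + b') (f + f') := fun _ _ _ _ _ _ => rfl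
  have mkX_sub : ∀ a b f a' b' f',
      mkX a b f - mkX a' b' f' = mkX (a - a') (b - b') (f - f') := fun _ _ _ _ _ _ => rfl
  have mkX_smul : ∀ (k : ℝ) a b f, k • mkX a b f = mkX (k • a) (k • b) (k • f) :=
    fun _ _ _ _ => rfl
  have mkX_sum : ∀ (s : Finset R) (c : R → ℝ),
      ∑ i ∈ s, c i • mkX i.1.1 (-i.1.2) (-e i) =
        mkX (∑ i ∈ s, c i • i.1.1) (-∑ i ∈ s, c i • i.1.2) (-∑ i ∈ s, c i • e i) := by
    intro s c
    induction s using Finset.induction_on with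
    | empty => simp only [Finset.sum_empty, neg_zero]; rfl
    | insert i s hi ih =>
      rw [Finset.sum_insert hi, ih, mkX_smul, mkX_add]
      simp only [Finset.sum_insert hi, smul_neg, neg_add]
  have norm_e : ∀ (s : Finset R) (c : R → ℝ),
      ‖∑ i ∈ s, c i • e i‖ = r * ∑ i ∈ s, |c i| := by
    intro s c
    have := lp.norm_sum_single (E := fun _ : R => ℝ) (p := 1) (by simp) (fun i => c i * r) s
    simp only [ENNReal.toReal_one, Real.rpow_one, norm_mul, Real.norm_eq_abs,
      abs_of_nonneg hr] at this
    rw [Finset.mul_sum]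
    simp_rw [mul_comm r]
    rw [← this]
    congr 1
    refine Finset.sum_congr rfl fun i _ => ?_
    exact (lp.single_smul _ _ _ _).symm
  let N : Submodule ℝ X := Submodule.span ℝ (Set.range fun i : R => mkX i.1.1 (-i.1.2) (-e i))
  have memN : ∀ m ∈ N, ∃ (s : Finset R) (c : R → ℝ),
      m = mkX (∑ i ∈ s, c i • i.1.1) (-∑ i ∈ s, c i • i.1.2) (-∑ i ∈ s, c i • e i) := by
    intro m hm
    obtain ⟨c, rfl⟩ := Finsupp.mem_span_range_iff_exists_finsupp.1 hm
    exact ⟨c.support, c, mkX_sum _ _⟩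
  let Q := X ⧸ N.topologicalClosure
  let π : X →ₗ[ℝ] Q := N.topologicalClosure.mkQ
  let jA : A →ₗ[ℝ] X :=
    { toFun := fun a => mkX a 0 0
      map_add' := fun a a' => by simp [mkX_add]
      map_smul' := fun k a => by simp [mkX_smul] }
  let jB : B →ₗ[ℝ] X :=
    { toFun := fun b => mkX 0 b 0
      map_add' := fun a a' => by simp [mkX_add]
      map_smul' := fun k a => by simp [mkX_smul] }
  have : IsClosed (N.topologicalClosure : Set X) := N.isClosed_topologicalClosure
  have hA : ∀ a, ‖π (jA a)‖ = ‖a‖ := by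
    intro a
    have hn : ‖jA a‖ = ‖a‖ := by simp [jA, norm_mkX]
    rw [← hn]
    refine norm_mk_topologicalClosure_eq N _ fun m hm => ?_
    obtain ⟨s, c, rfl⟩ := memN m hm
    rw [hn]
    change _ ≤ ‖mkX a 0 0 + _‖
    rw [mkX_add, norm_mkX, zero_add, zero_add, norm_neg, norm_neg, norm_e]
    have h1 := norm_sub_le (a + ∑ i ∈ s, c i • i.1.1) (∑ i ∈ s, c i • i.1.1)
    rw [add_sub_cancel_right] at h1
    linarith [(abs_le.1 (h s c)).2]
  have hB : ∀ b, ‖π (jB b)‖ = ‖b‖ := by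
    intro b
    have hn : ‖jB b‖ = ‖b‖ := by simp [jB, norm_mkX]
    rw [← hn]
    refine norm_mk_topologicalClosure_eq N _ fun m hm => ?_
    obtain ⟨s, c, rfl⟩ := memN m hm
    rw [hn]
    change _ ≤ ‖mkX 0 b 0 + _‖
    rw [mkX_add, norm_mkX, zero_add, zero_add, norm_neg, norm_e]
    have h1 := norm_add_le (b + -∑ i ∈ s, c i • i.1.2) (∑ i ∈ s, c i • i.1.2)
    rw [neg_add_cancel_right] at h1
    linarith [(abs_le.1 (h s c)).1]
  refine ⟨Q, inferInstance, inferInstance, inferInstance,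
    ⟨π ∘ₗ jA, hA⟩, ⟨π ∘ₗ jB, hB⟩, fun p hp => ?_⟩
  have hmem : mkX p.1 (-p.2) (-e ⟨p, hp⟩) ∈ N.topologicalClosure :=
    N.le_topologicalClosure (Submodule.subset_span ⟨⟨p, hp⟩, rfl⟩)
  have heq : π (jA p.1) - π (jB p.2) = π (mkX 0 0 (e ⟨p, hp⟩)) := by
    rw [← map_sub]
    refine (Submodule.Quotient.eq _).2 ?_
    change mkX p.1 0 0 - mkX 0 p.2 0 - _ ∈ _
    simpa [mkX_sub] using hmem
  change ‖π (jA p.1) - π (jB p.2)‖ ≤ r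
  rw [heq]
  refine (Submodule.Quotient.norm_mk_le _ _).trans ?_
  have := norm_e {⟨p, hp⟩} 1
  simp only [Finset.sum_singleton, Pi.one_apply, one_smul, abs_one, mul_one] at this
  rw [norm_mkX, this]
  simp

/-- For real Banach spaces `A`, `B` with fixed dense subsets `Â`, `B̂` of
their closed unit balls and `ε > 0`: having, for some `ε' ∈ (0, ε)`, a correspondence
between `Â` and `B̂` realized by linear isometric embeddings of `A` and `B` into a
common Banach space with related points at distance `≤ ε'`, is equivalent to having,
for some `ε' ∈ (0, ε)`, a correspondence between `Â` and `B̂` preserving the norms of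
all absolutely convex combinations up to additive error `ε'`. -/
theorem stmt17 {A B : Type}
    [NormedAddCommGroup A] [NormedSpace ℝ A] [CompleteSpace A]
    [NormedAddCommGroup B] [NormedSpace ℝ B] [CompleteSpace B]
    (Ahat : Set A) (Bhat : Set B)
    (hA₁ : Ahat ⊆ Metric.closedBall 0 1) (hA₂ : Metric.closedBall 0 1 ⊆ closure Ahat)
    (hB₁ : Bhat ⊆ Metric.closedBall 0 1) (hB₂ : Metric.closedBall 0 1 ⊆ closure Bhat)
    (ε : ℝ) (hε : 0 < ε) :
    (∃ ε' : ℝ, ε' ∈ Set.Ioo 0 ε ∧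
      ∃ R : Set (A × B),
        Prod.fst '' R = Ahat ∧ Prod.snd '' R = Bhat ∧
        ∃ (C : Type) (_ : NormedAddCommGroup C) (_ : NormedSpace ℝ C)
          (_ : CompleteSpace C) (ιA : A →ₗᵢ[ℝ] C) (ιB : B →ₗᵢ[ℝ] C),
          ∀ p ∈ R, ‖ιA p.1 - ιB p.2‖ ≤ ε') ↔
    (∃ ε' : ℝ, ε' ∈ Set.Ioo 0 ε ∧
      ∃ R : Set (A × B),
        Prod.fst '' R = Ahat ∧ Prod.snd '' R = Bhat ∧
        ∀ (n : ℕ) (p : Fin n → A × B), (∀ i, p i ∈ R) →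
          ∀ lam : Fin n → ℝ, ∑ i, |lam i| = 1 →
            |‖∑ i, lam i • (p i).1‖ - ‖∑ i, lam i • (p i).2‖| ≤ ε') := by
  constructor
  · rintro ⟨r, hr, R, hR₁, hR₂, C, _, _, _, ιA, ιB, hι⟩
    refine ⟨r, hr, R, hR₁, hR₂, fun n p hp lam hlam => ?_⟩
    rw [← ιA.norm_map, ← ιB.norm_map]
    refine (abs_norm_sub_norm_le _ _).trans ?_
    simp only [map_sum, map_smul, ← Finset.sum_sub_distrib, ← smul_sub]
    calc ‖∑ i, lam i • (ιA (p i).1 - ιB (p i).2)‖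
        ≤ ∑ i, |lam i| * r := norm_sum_le_of_le _ fun i _ => by
          rw [norm_smul, Real.norm_eq_abs]
          exact mul_le_mul_of_nonneg_left (hι _ (hp i)) (abs_nonneg _)
      _ = r := by rw [← Finset.sum_mul, hlam, one_mul]
  · rintro ⟨r, hr, R, hR₁, hR₂, h⟩
    exact ⟨r, hr, R, hR₁, hR₂,
      exists_common_isometric_extension hr.1.le (abs_norm_sub_norm_le_of_absConvex h)⟩
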